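/- arXiv:1503.04383 — 3 statements merged into one kernel-verified Lean document; each statement's English description precedes it below -/
import Mathlib

section
/- Let X be a Polish topological space (separable and completely metrizable) and let d be any metric on X compatible with its topology. Then the hyperspace CL(X) of nonempty closed subsets of X, equipped with the topology induced by the Hausdorff extended metric H_d, is completely metrizable. -/
open TopologicalSpace

/-- `CL X` is the hyperspace of nonempty closed subsets of `X`, equipped (via the instance
below) with the Hausdorff extended metric, and hence with the Hausdorff metric topology. -/
def CL (X : Type*) [EMetricSpace X] : Type _ :=
  {s : TopologicalSpace.Closeds X // (s : Set X).Nonempty}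

/-- The Hausdorff extended metric on the hyperspace of nonempty closed sets:
`edist A B` is the Hausdorff extended distance `hausdorffEdist (A : Set X) (B : Set X)`. -/
noncomputable instance CL.instEMetricSpace (X : Type*) [EMetricSpace X] :
    EMetricSpace (CL X) :=
  inferInstanceAs (EMetricSpace {s : TopologicalSpace.Closeds X // (s : Set X).Nonempty})

/-- A topological space is completely metrizable if some complete metric induces its topology. -/
def IsCompletelyMetrizable (Z : Type*) [t : TopologicalSpace Z] : Prop :=
  ∃ m : MetricSpace Z, m.toUniformSpace.toTopologicalSpace = t ∧ @CompleteSpace Z m.toUniformSpace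

open Set Filter Topology in
/-- A `Gδ` subset of a completely metrizable space is completely metrizable. -/
theorem IsGδ.isCompletelyMetrizableSpace {Z : Type*} [TopologicalSpace Z]
    [IsCompletelyMetrizableSpace Z] {s : Set Z} (hs : IsGδ s) :
    IsCompletelyMetrizableSpace s := by
  obtain ⟨U, hU, rfl⟩ := isGδ_iff_eq_iInter_nat.1 hs
  have (n : ℕ) : IsCompletelyMetrizableSpace (U n) := by
    let := upgradeIsCompletelyMetrizable Z
    exact inferInstanceAs (IsCompletelyMetrizableSpace (Opens.CompleteCopy ⟨U n, hU n⟩))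
  let f : (⋂ n, U n : Set Z) → ∀ n, U n := fun x n ↦ ⟨x, mem_iInter.1 x.2 n⟩
  have hf : Continuous f := by fun_prop
  have hg : Continuous fun u : ∀ n, U n ↦ (u 0 : Z) := by fun_prop
  have hrange : range f = ⋂ n, {u | (u n : Z) = u 0} := by
    ext u
    simp only [mem_range, mem_iInter, mem_ofPred_eq]
    refine ⟨?_, fun h ↦ ⟨⟨u 0, mem_iInter.2 fun n ↦ h n ▸ (u n).2⟩, ?_⟩⟩
    · rintro ⟨x, rfl⟩ n
      rfl
    · ext n
      exact (h n).symm
  refine IsClosedEmbedding.IsCompletelyMetrizableSpace (f := f)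
    ⟨.of_comp hf hg IsEmbedding.subtypeVal, ?_⟩
  rw [hrange]
  exact isClosed_iInter fun n ↦ isClosed_eq (by fun_prop) hg

open Set Filter Topology in
/-- A completely metrizable space is a `Gδ` subset of every Hausdorff space in which it is densely
embedded. -/
theorem Topology.IsEmbedding.isGδ_range_of_denseRange {X Y : Type*} [TopologicalSpace X]
    [IsCompletelyMetrizableSpace X] [TopologicalSpace Y] [T2Space Y] {i : X → Y}
    (hi : IsEmbedding i) (hd : DenseRange i) : IsGδ (range i) := by
  let := upgradeIsCompletelyMetrizable X
  let U (n : ℕ) : Set Y :=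
    {y | ∃ W, IsOpen W ∧ y ∈ W ∧ ∀ a b, i a ∈ W → i b ∈ W → dist a b < 1 / ((n : ℝ) + 1)}
  have hU (n : ℕ) : IsOpen (U n) := by
    refine isOpen_iff_forall_mem_open.2 ?_
    rintro y ⟨W, hW, hy, h⟩
    exact ⟨W, fun z hz ↦ ⟨W, hW, hz, h⟩, hW, hy⟩
  suffices range i = ⋂ n, U n from this ▸ IsGδ.iInter_of_isOpen hU
  refine Subset.antisymm ?_ fun y hy ↦ ?_
  · rintro _ ⟨x, rfl⟩
    refine mem_iInter.2 fun n ↦ ?_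
    have hn : (0 : ℝ) < 1 / ((n : ℝ) + 1) := Nat.one_div_pos_of_nat
    obtain ⟨W, hW, hWx⟩ := hi.isOpen_iff.1
      (Metric.isOpen_ball (x := x) (ε := 1 / ((n : ℝ) + 1) / 2))
    refine ⟨W, hW, ?_, fun a b ha hb ↦ ?_⟩
    · change x ∈ i ⁻¹' W
      rw [hWx]
      exact Metric.mem_ball_self (half_pos hn)
    · have ha' : a ∈ i ⁻¹' W := ha
      have hb' : b ∈ i ⁻¹' W := hb
      rw [hWx, Metric.mem_ball] at ha' hb'
      linarith [dist_triangle_right a b x]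
  · have hne : (comap i (𝓝 y)).NeBot :=
      comap_neBot_iff.2 fun t ht ↦ hd.mem_nhds ht
    have hc : Cauchy (comap i (𝓝 y)) := by
      refine Metric.cauchy_iff.2 ⟨hne, fun ε hε ↦ ?_⟩
      obtain ⟨n, hn⟩ := exists_nat_one_div_lt hε
      obtain ⟨W, hW, hyW, h⟩ := mem_iInter.1 hy n
      exact ⟨i ⁻¹' W, preimage_mem_comap (hW.mem_nhds hyW),
        fun a ha b hb ↦ (h a b ha hb).trans hn⟩
    obtain ⟨x, hx⟩ := CompleteSpace.complete hc
    exact ⟨x, tendsto_nhds_unique ((hi.continuous.tendsto x).mono_left hx) tendsto_comap⟩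

open Set in
/-- By the Baire category theorem, a closed set in which countably many open sets have dense traces
also has a dense trace of their intersection. -/
theorem IsClosed.subset_closure_inter_iInter {Y : Type*} [MetricSpace Y] [CompleteSpace Y]
    {F : Set Y} (hF : IsClosed F) {U : ℕ → Set Y} (hU : ∀ n, IsOpen (U n))
    (h : ∀ n, F ⊆ closure (F ∩ U n)) : F ⊆ closure (F ∩ ⋂ n, U n) := by
  have : CompleteSpace F := hF.completeSpace_coe
  have hd : Dense (⋂ n, ((↑) : F → Y) ⁻¹' U n) := by
    refine dense_iInter_of_isOpen_nat (fun n ↦ (hU n).preimage continuous_subtype_val) fun n ↦ ?_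
    refine Subtype.dense_iff.2 ?_
    simpa only [Subtype.image_preimage_coe] using h n
  simpa only [← preimage_iInter, Subtype.image_preimage_coe] using Subtype.dense_iff.1 hd

namespace TopologicalSpace.Closeds

open Set

/-- The closed sets in which a given open set has dense trace form a `Gδ` set for the Hausdorff
metric. -/
theorem isGδ_setOf_subset_closure_inter_of_isOpen {Y : Type*} [EMetricSpace Y]
    [SecondCountableTopology Y] {U : Set Y} (hU : IsOpen U) :
    IsGδ {F : Closeds Y | (F : Set Y) ⊆ closure (F ∩ U)} := by
  have hrw : {F : Closeds Y | (F : Set Y) ⊆ closure (F ∩ U)} = ⋂ V ∈ countableBasis Y,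
      ({F : Closeds Y | ((F : Set Y) ∩ V).Nonempty}ᶜ ∪
        {F : Closeds Y | ((F : Set Y) ∩ (V ∩ U)).Nonempty}) := by
    ext F
    simp only [mem_iInter, mem_union, mem_compl_iff, mem_ofPred_eq, ← imp_iff_not_or]
    refine ⟨?_, fun h x hx ↦ ?_⟩
    · rintro h V hV ⟨x, hxF, hxV⟩
      obtain ⟨y, hyV, hyF, hyU⟩ :=
        mem_closure_iff.1 (h hxF) V (isOpen_of_mem_countableBasis hV) hxV
      exact ⟨y, hyF, hyV, hyU⟩
    · refine (isBasis_countableBasis Y).mem_closure_iff.2 fun V hV hxV ↦ ?_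
      obtain ⟨y, hyF, hyV, hyU⟩ := h V hV ⟨x, hx, hxV⟩
      exact ⟨y, hyV, hyF, hyU⟩
  rw [hrw]
  refine IsGδ.biInter (countable_countableBasis Y) fun V hV ↦ ?_
  have hVo := isOpen_of_mem_countableBasis hV
  exact (isOpen_inter_nonempty_of_isOpen hVo).isClosed_compl.isGδ.union
    (isOpen_inter_nonempty_of_isOpen (hVo.inter hU)).isGδ

/-- The closed sets in which a given `Gδ` set has dense trace form a `Gδ` set for the Hausdorff
metric. -/
theorem isGδ_setOf_subset_closure_inter {Y : Type*} [MetricSpace Y] [CompleteSpace Y]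
    [SecondCountableTopology Y] {G : Set Y} (hG : IsGδ G) :
    IsGδ {F : Closeds Y | (F : Set Y) ⊆ closure (F ∩ G)} := by
  obtain ⟨U, hU, rfl⟩ := isGδ_iff_eq_iInter_nat.1 hG
  suffices {F : Closeds Y | (F : Set Y) ⊆ closure (F ∩ ⋂ n, U n)} =
      ⋂ n, {F : Closeds Y | (F : Set Y) ⊆ closure (F ∩ U n)} from
    this ▸ IsGδ.iInter fun n ↦ isGδ_setOf_subset_closure_inter_of_isOpen (hU n)
  ext F
  simp only [mem_iInter, mem_ofPred_eq]
  exact ⟨fun h n ↦ h.trans <| closure_mono <| inter_subset_inter_right _ <| iInter_subset _ n,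
    F.isClosed.subset_closure_inter_iInter hU⟩

end TopologicalSpace.Closeds

namespace CL

open Set Topology UniformSpace

/-- The map sending a nonempty closed subset of `X` to its closure in the completion of `X`. -/
noncomputable def closureInCompletion {X : Type*} [MetricSpace X] (s : CL X) :
    Closeds (Completion X) :=
  Closeds.closure ((↑) '' (s.1 : Set X))

theorem isometry_closureInCompletion {X : Type*} [MetricSpace X] :
    Isometry (closureInCompletion (X := X)) := fun _ _ ↦
  Metric.hausdorffEDist_closure.trans (Metric.hausdorffEDist_image Completion.coe_isometry)

theorem range_closureInCompletion {X : Type*} [MetricSpace X] :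
    range (closureInCompletion (X := X)) =
      {F : Closeds (Completion X) | ((F : Set (Completion X)) ∩ univ).Nonempty} ∩
        {F | (F : Set (Completion X)) ⊆ closure (F ∩ range ((↑) : X → Completion X))} := by
  ext F
  constructor
  · rintro ⟨s, rfl⟩
    obtain ⟨x, hx⟩ := s.2
    exact ⟨⟨x, subset_closure (mem_image_of_mem _ hx), mem_univ _⟩,
      closure_mono <| subset_inter subset_closure (image_subset_range _ _)⟩
  · rintro ⟨⟨y, hy, -⟩, h⟩
    have hne : ((F : Set (Completion X)) ∩ range ((↑) : X → Completion X)).Nonempty :=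
      closure_nonempty_iff.1 ⟨y, h hy⟩
    obtain ⟨_, hx, x, rfl⟩ := hne
    refine ⟨⟨⟨((↑) : X → Completion X) ⁻¹' F,
      F.isClosed.preimage (Completion.continuous_coe X)⟩, x, hx⟩, Closeds.ext ?_⟩
    change closure (((↑) : X → Completion X) '' ((↑) ⁻¹' (F : Set (Completion X)))) = F
    rw [image_preimage_eq_inter_range]
    exact (closure_minimal inter_subset_left F.isClosed).antisymm h

end CL

/-- If `X` is a Polish topological space (separable and completely metrizable) and `d` is any
compatible metric on `X` (here: `X` is a metric space whose metric topology is Polish), then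
the hyperspace `CL(X)` with the topology induced by the Hausdorff extended metric `H_d`
is completely metrizable. -/
theorem stmt1 (X : Type*) [MetricSpace X] [PolishSpace X] :
    IsCompletelyMetrizable (CL X) := by
  have : SecondCountableTopology (UniformSpace.Completion X) :=
    UniformSpace.secondCountable_of_separable _
  have hG : IsGδ (Set.range ((↑) : X → UniformSpace.Completion X)) :=
    (UniformSpace.Completion.isUniformEmbedding_coe X).isEmbedding.isGδ_range_of_denseRange
      UniformSpace.Completion.denseRange_coe
  have hr : IsGδ (Set.range (CL.closureInCompletion (X := X))) := by
    rw [CL.range_closureInCompletion]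
    exact (Closeds.isOpen_inter_nonempty_of_isOpen isOpen_univ).isGδ.inter
      (Closeds.isGδ_setOf_subset_closure_inter hG)
  have := hr.isCompletelyMetrizableSpace
  exact (CL.isometry_closureInCompletion.isEmbedding.toHomeomorph.isClosedEmbedding
    |>.IsCompletelyMetrizableSpace).complete
end

section
/- There exists a metric space (X, d) such that d is bounded, the topological space X (with the topology induced by d) is completely metrizable, and the hyperspace CL(X), equipped with the topology induced by the Hausdorff metric H_d, is not completely metrizable. -/
open TopologicalSpace

open Filter Topology

/-- A completely metrizable space admits a choice of neighbourhoods such that every sequence whose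
next term always lies in the neighbourhood chosen for the current one converges. -/
theorem IsCompletelyMetrizable.exists_nhds_strategy {Z : Type*} [t : TopologicalSpace Z]
    (h : IsCompletelyMetrizable Z) :
    ∃ U : ℕ → Z → Set Z, (∀ n z, U n z ∈ 𝓝 z) ∧
      ∀ s : ℕ → Z, (∀ n, s (n + 1) ∈ U n (s n)) → ∃ a, Tendsto s atTop (𝓝 a) := by
  obtain ⟨m, rfl, hc⟩ := h
  refine ⟨fun n z => Metric.ball z ((1 : ℝ) / 2 / 2 ^ n),
    fun n z => Metric.ball_mem_nhds z (by positivity), fun s hs => ?_⟩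
  exact cauchySeq_tendsto_of_complete
    (cauchySeq_of_le_geometric_two (C := 1) fun n => (Metric.mem_ball'.1 (hs n)).le)

/-- The disjoint union of `I` copies of `ℕ`, metrized so that each copy is a discrete sequence
converging to a missing point at infinity, and distinct copies lie at distance `2`. -/
structure Comb (I : Type*) where
  /-- The copy of `ℕ` containing the point. -/
  index : I
  /-- The position of the point within its copy of `ℕ`. -/
  height : ℕ

namespace Comb

variable {I : Type*}

/-- The distance from a point to the missing end of its copy of `ℕ`. -/
noncomputable def weight (P : Comb I) : ℝ := 1 / ((P.height : ℝ) + 1)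

theorem weight_pos (P : Comb I) : 0 < weight P := by
  unfold weight; positivity

theorem weight_le_one (P : Comb I) : weight P ≤ 1 := by
  unfold weight
  rw [div_le_one (by positivity)]
  linarith [(Nat.cast_nonneg P.height : (0 : ℝ) ≤ P.height)]

open Classical in
noncomputable instance : MetricSpace (Comb I) where
  dist P Q := if P = Q then 0 else if P.index = Q.index then weight P + weight Q else 2
  dist_self P := by simp
  dist_comm P Q := by simp only [eq_comm (a := P), eq_comm (a := P.index), add_comm (weight P)]
  dist_triangle P Q R := by
    have hP := weight_pos P
    have hQ := weight_pos Q
    have hR := weight_pos R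
    have hP' := weight_le_one P
    have hR' := weight_le_one R
    split_ifs <;> first | linarith | simp_all
  eq_of_dist_eq_zero {P Q} h := by
    have hP := weight_pos P
    have hQ := weight_pos Q
    by_contra hne
    simp only [hne, if_false] at h
    split_ifs at h <;> linarith

open Classical in
theorem dist_def (P Q : Comb I) :
    dist P Q = if P = Q then 0 else if P.index = Q.index then weight P + weight Q else 2 := rfl

theorem dist_le_two (P Q : Comb I) : dist P Q ≤ 2 := by
  have hP := weight_le_one P
  have hQ := weight_le_one Q
  rw [dist_def]
  split_ifs <;> linarith

theorem eq_of_dist_lt_weight {P Q : Comb I} (h : dist P Q < weight P) : P = Q := by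
  by_contra hne
  have hP := weight_le_one P
  have hQ := weight_pos Q
  rw [dist_def, if_neg hne] at h
  split_ifs at h <;> linarith

theorem index_eq_of_dist_lt_two {P Q : Comb I} (h : dist P Q < 2) : P.index = Q.index := by
  by_contra hne
  rw [dist_def, if_neg fun e => hne (congrArg _ e), if_neg hne] at h
  exact lt_irrefl _ h

instance : DiscreteTopology (Comb I) := by
  refine discreteTopology_iff_isOpen_singleton.2 fun P => ?_
  refine Metric.isOpen_iff.2 fun Q hQ => ⟨weight P, weight_pos P, fun R hR => ?_⟩
  obtain rfl : Q = P := hQ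
  exact (eq_of_dist_lt_weight (Metric.mem_ball'.1 hR)).symm

/-- The graph of a function `I → ℕ`, as a nonempty closed set. -/
def graph [Nonempty I] (f : I → ℕ) : CL (Comb I) :=
  ⟨⟨Set.range fun i => (⟨i, f i⟩ : Comb I), isClosed_discrete _⟩, Set.range_nonempty _⟩

theorem edist_graph_le [Nonempty I] {f g : I → ℕ} {k : ℕ}
    (h : ∀ i, f i = g i ∨ k < f i ∧ k < g i) :
    edist (graph g) (graph f) ≤ ENNReal.ofReal (2 / ((k : ℝ) + 1)) := by
  have key : ∀ i, dist (⟨i, f i⟩ : Comb I) ⟨i, g i⟩ ≤ 2 / ((k : ℝ) + 1) := by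
    intro i
    rcases h i with h | ⟨h₁, h₂⟩
    · rw [h, dist_self]; positivity
    · have hw : ∀ n : ℕ, k < n → weight (⟨i, n⟩ : Comb I) ≤ 1 / ((k : ℝ) + 1) := fun n hn =>
        one_div_le_one_div_of_le (by positivity) (by
          have : (k : ℝ) < n := by exact_mod_cast hn
          change (k : ℝ) + 1 ≤ (n : ℝ) + 1
          linarith)
      rw [dist_def]
      split_ifs with e₁ e₂
      · positivity
      · refine (add_le_add (hw _ h₁) (hw _ h₂)).trans_eq (by ring)
      · exact absurd rfl e₂
  change Metric.hausdorffEDist (Set.range fun i => (⟨i, g i⟩ : Comb I))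
    (Set.range fun i => (⟨i, f i⟩ : Comb I)) ≤ _
  refine Metric.hausdorffEDist_le_of_mem_edist ?_ ?_
  · rintro _ ⟨i, rfl⟩
    refine ⟨_, ⟨i, rfl⟩, ?_⟩
    rw [edist_comm, edist_dist]
    exact ENNReal.ofReal_le_ofReal (key i)
  · rintro _ ⟨i, rfl⟩
    refine ⟨_, ⟨i, rfl⟩, ?_⟩
    rw [edist_dist]
    exact ENNReal.ofReal_le_ofReal (key i)

theorem exists_forall_graph_mem_of_mem_nhds [Nonempty I] {f : I → ℕ} {U : Set (CL (Comb I))}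
    (hU : U ∈ 𝓝 (graph f)) (n : ℕ) :
    ∃ k, n ≤ k ∧ ∀ g : I → ℕ, (∀ i, f i = g i ∨ k < f i ∧ k < g i) → graph g ∈ U := by
  obtain ⟨δ, hδ, hball⟩ := EMetric.mem_nhds_iff.1 hU
  have hlim : Tendsto (fun k : ℕ => ENNReal.ofReal (2 / ((k : ℝ) + 1))) atTop (𝓝 0) := by
    have := ENNReal.tendsto_ofReal (tendsto_const_div_atTop_nhds_zero_nat (2 : ℝ) |>.comp
      (tendsto_add_atTop_nat 1))
    simpa [Function.comp_def] using this
  obtain ⟨k, hk, hnk⟩ := ((hlim.eventually_lt_const hδ).and (eventually_ge_atTop n)).exists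
  exact ⟨k, hnk, fun g hg => hball ((edist_graph_le hg).trans_lt hk)⟩

/-- If the graphs of `f n` converge, then no point can satisfy `f n i → ∞`. -/
theorem not_tendsto_atTop_of_tendsto_graph [Nonempty I] {f : ℕ → I → ℕ} {A : CL (Comb I)}
    (hA : Tendsto (fun n => graph (f n)) atTop (𝓝 A)) (i : I) :
    ¬ Tendsto (fun n => f n i) atTop atTop := by
  intro hi
  have hclose : ∀ r : ℝ, 0 < r → ∀ᶠ n in atTop,
      Metric.hausdorffEDist (A.1 : Set (Comb I)) (graph (f n)).1 < ENNReal.ofReal r := by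
    intro r hr
    filter_upwards [hA.eventually (Metric.eball_mem_nhds A (ENNReal.ofReal_pos.2 hr))] with n hn
    rw [Metric.hausdorffEDist_comm]
    exact hn
  obtain ⟨n, hn⟩ := (hclose 2 two_pos).exists
  rw [Metric.hausdorffEDist_comm] at hn
  obtain ⟨⟨j, p⟩, hP, hd⟩ := Metric.exists_edist_lt_of_hausdorffEDist_lt
    (x := (⟨i, f n i⟩ : Comb I))
    (s := Set.range fun j => (⟨j, f n j⟩ : Comb I)) ⟨i, rfl⟩ hn
  rw [edist_dist, ENNReal.ofReal_lt_ofReal_iff two_pos] at hd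
  obtain rfl : i = j := index_eq_of_dist_lt_two hd
  obtain ⟨l, hl, hpl⟩ :=
    ((hclose _ (weight_pos (⟨i, p⟩ : Comb I))).and (hi.eventually_gt_atTop p)).exists
  obtain ⟨_, ⟨j, rfl⟩, hd⟩ := Metric.exists_edist_lt_of_hausdorffEDist_lt hP hl
  rw [edist_dist, ENNReal.ofReal_lt_ofReal_iff (weight_pos _)] at hd
  have heq := Comb.mk.inj (eq_of_dist_lt_weight hd)
  obtain rfl : i = j := heq.1
  exact hpl.ne heq.2

theorem not_isCompletelyMetrizable_CL : ¬ IsCompletelyMetrizable (CL (Comb (ℕ → ℕ))) := by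
  intro h
  obtain ⟨U, hU, hconv⟩ := h.exists_nhds_strategy
  have hK' (f : (ℕ → ℕ) → ℕ) (n : ℕ) := exists_forall_graph_mem_of_mem_nhds (hU n (graph f)) n
  choose K hK hKU using hK'
  let step (n : ℕ) (g : (ℕ → ℕ) → ℕ) : (ℕ → ℕ) → ℕ := fun y =>
    if K g n < g y then K g n + 1 + y (n + 1) else g y
  let f (n : ℕ) : (ℕ → ℕ) → ℕ := Nat.rec (fun y => y 0 + 1) step n
  have hf (n : ℕ) (y : ℕ → ℕ) : f (n + 1) y = step n (f n) y := rfl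
  obtain ⟨A, hA⟩ := hconv (fun n => graph (f n)) fun n => hKU (f n) n _ fun y => by
    simp only [hf, step]
    split_ifs with hy
    · exact Or.inr ⟨hy, by omega⟩
    · exact Or.inl rfl
  let x : ℕ → ℕ := fun n => K (f n) n
  have hx : ∀ n, K (f n) n < f n x := by
    intro n
    induction n with
    | zero => exact Nat.lt_succ_self _
    | succ n ih =>
      simp only [hf n x, step, if_pos ih]
      change K (f (n + 1)) (n + 1) < K (f n) n + 1 + K (f (n + 1)) (n + 1)
      omega
  exact not_tendsto_atTop_of_tendsto_graph hA x
    (tendsto_atTop_mono (fun n => (hK (f n) n).trans (hx n).le) tendsto_id)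

end Comb

/-- There is a bounded metric space `(X, d)` such that `X` (with the metric topology) is
completely metrizable, yet the hyperspace `CL(X)` with the topology induced by the Hausdorff
metric `H_d` is not completely metrizable. -/
theorem stmt11 :
    ∃ (X : Type) (_ : MetricSpace X),
      (∃ C : ℝ, ∀ x y : X, dist x y ≤ C) ∧
      IsCompletelyMetrizable X ∧
      ¬ IsCompletelyMetrizable (CL X) :=
  ⟨Comb (ℕ → ℕ), inferInstance, ⟨2, Comb.dist_le_two⟩,
    IsCompletelyMetrizableSpace.complete, Comb.not_isCompletelyMetrizable_CL⟩
end

section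
/- There exists a metric space (X, d) such that d is bounded, the topological space X is completely metrizable, and the hyperspace CL(X) with the Hausdorff metric H_d simultaneously satisfies: (i) CL(X) contains a closed subspace homeomorphic to the rationals ℚ, so CL(X) is not completely metrizable; and (ii) CL(X) contains a dense completely metrizable subspace, so CL(X) is a Baire space. -/
open TopologicalSpace

open Set Filter Topology Metric

theorem isCompletelyMetrizable_iff {Z : Type*} [TopologicalSpace Z] :
    IsCompletelyMetrizable Z ↔ IsCompletelyMetrizableSpace Z :=
  ⟨fun h => ⟨h⟩, fun h => h.complete⟩

theorem isCompletelyMetrizableSpace_of_isOpen {Y : Type*} [TopologicalSpace Y]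
    [IsCompletelyMetrizableSpace Y] {s : Set Y} (hs : IsOpen s) :
    IsCompletelyMetrizableSpace s := by
  let := upgradeIsCompletelyMetrizable Y
  exact inferInstanceAs (IsCompletelyMetrizableSpace (Opens.CompleteCopy ⟨s, hs⟩))

theorem baireSpace_of_dense_baireSpace {Y : Type*} [TopologicalSpace Y] {s : Set Y}
    (hs : Dense s) [BaireSpace s] : BaireSpace Y where
  baire_property f ho hd := by
    have hdense : Dense (⋂ n, ((↑) : s → Y) ⁻¹' f n) :=
      dense_iInter_of_isOpen (fun n => (ho n).preimage continuous_subtype_val) fun n => by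
        rw [Subtype.dense_iff]
        intro x _
        rw [Subtype.image_preimage_coe, inter_comm]
        exact (hd n).inter_of_isOpen_left hs (ho n) x
    have := hs.denseRange_val.dense_image continuous_subtype_val hdense
    refine this.mono ?_
    rintro _ ⟨x, hx, rfl⟩
    simpa using hx

theorem Rat.not_isCompletelyMetrizableSpace : ¬ IsCompletelyMetrizableSpace ℚ := fun _ => by
  have hd : Dense (⋂ q : ℚ, ({q}ᶜ : Set ℚ)) :=
    dense_iInter_of_isOpen (fun q => isOpen_compl_singleton) fun q => dense_compl_singleton q
  obtain ⟨x, hx⟩ := hd.nonempty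
  exact mem_iInter.1 hx x rfl

/-- A family of unit intervals indexed by the irrational numbers, pairwise at distance at
least `1`. -/
def IrrationalFan : Type := Σ _ : {x : ℝ // Irrational x}, unitInterval

namespace IrrationalFan

noncomputable instance : MetricSpace IrrationalFan := Metric.Sigma.metricSpace

instance : CompleteSpace IrrationalFan := Metric.Sigma.completeSpace

/-- The irrational number indexing the interval that contains a point. -/
def base (p : IrrationalFan) : ℝ := p.1

/-- The coordinate of a point in its interval. -/
def height (p : IrrationalFan) : ℝ := p.2

theorem irrational_base (p : IrrationalFan) : Irrational p.base := p.1.2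

theorem height_nonneg (p : IrrationalFan) : 0 ≤ p.height := p.2.2.1

theorem height_le_one (p : IrrationalFan) : p.height ≤ 1 := p.2.2.2

theorem exists_base_eq_height_eq {y t : ℝ} (hy : Irrational y) (h0 : 0 ≤ t) (h1 : t ≤ 1) :
    ∃ p : IrrationalFan, p.base = y ∧ p.height = t :=
  ⟨⟨⟨y, hy⟩, ⟨t, h0, h1⟩⟩, rfl, rfl⟩

theorem dist_eq_of_base_eq {p q : IrrationalFan} (h : p.base = q.base) :
    dist p q = |p.height - q.height| := by
  obtain ⟨x, s⟩ := p
  obtain ⟨y, t⟩ := q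
  obtain rfl : x = y := Subtype.ext h
  exact (Metric.Sigma.dist_same (E := fun _ : {x : ℝ // Irrational x} => unitInterval) x s t).trans
    (Real.dist_eq _ _)

theorem base_eq_of_dist_lt_one {p q : IrrationalFan} (h : dist p q < 1) : p.base = q.base :=
  congrArg Subtype.val (Metric.Sigma.fst_eq_of_dist_lt_one p q h)

theorem dist_le_three (p q : IrrationalFan) : dist p q ≤ 3 := by
  have key (a b : unitInterval) : dist a b ≤ 1 := by
    rw [Subtype.dist_eq, Real.dist_eq, abs_le]
    constructor <;> linarith [a.2.1, a.2.2, b.2.1, b.2.2]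
  obtain ⟨x, s⟩ := p
  obtain ⟨y, t⟩ := q
  obtain rfl | h := eq_or_ne x y
  · have := Metric.Sigma.dist_same (E := fun _ : {x : ℝ // Irrational x} => unitInterval) x s t
    exact this.trans_le ((key s t).trans (by norm_num))
  · have := Metric.Sigma.dist_ne (E := fun _ : {x : ℝ // Irrational x} => unitInterval) h s t
    refine this.trans_le ?_
    linarith [key s (Nonempty.some ⟨s⟩), key (Nonempty.some ⟨t⟩) t]

theorem abs_height_sub_le (p q : IrrationalFan) : |p.height - q.height| ≤ dist p q := by
  obtain h | h := lt_or_ge (dist p q) 1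
  · exact (dist_eq_of_base_eq (base_eq_of_dist_lt_one h)).ge
  · refine le_trans (abs_le.2 ⟨?_, ?_⟩) h <;>
      linarith [p.height_nonneg, q.height_nonneg, p.height_le_one, q.height_le_one]

theorem continuous_height : Continuous height :=
  (LipschitzWith.of_dist_le_mul (K := 1) fun p q => by
    simpa [Real.dist_eq] using abs_height_sub_le p q).continuous

theorem continuous_base : Continuous base :=
  Metric.continuous_iff.2 fun p ε hε => ⟨1, one_pos, fun q hq => by
    rwa [base_eq_of_dist_lt_one hq, dist_self]⟩

/-- The points of positive height: an open, hence completely metrizable, subspace. -/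
abbrev Positive : Type := {p : IrrationalFan // 0 < p.height}

theorem isCompletelyMetrizableSpace_positive : IsCompletelyMetrizableSpace Positive :=
  isCompletelyMetrizableSpace_of_isOpen
    (isOpen_lt (continuous_const (y := (0 : ℝ))) continuous_height)

theorem edist_lt_ofReal_iff {p q : IrrationalFan} {ε : ℝ} :
    edist p q < ENNReal.ofReal ε ↔ dist p q < ε := by
  rw [edist_dist, ENNReal.ofReal_lt_ofReal_iff_of_nonneg dist_nonneg]

/-- The nonempty closed sets whose heights are bounded away from zero. -/
def awayFromZero : Set (Closeds IrrationalFan) :=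
  {G | (G : Set IrrationalFan).Nonempty ∧ ∃ ε > 0, ∀ p ∈ G, ε ≤ p.height}

theorem isOpen_awayFromZero : IsOpen awayFromZero := by
  rw [EMetric.isOpen_iff]
  rintro G ⟨hne, ε, hε, hG⟩
  refine ⟨ENNReal.ofReal (ε / 2), by simpa using hε, fun G' hG' => ?_⟩
  have hG' : hausdorffEDist (G' : Set IrrationalFan) G < ENNReal.ofReal (ε / 2) := hG'
  refine ⟨nonempty_of_hausdorffEDist_ne_top hne ?_, ε / 2, half_pos hε, fun p hp => ?_⟩
  · rw [hausdorffEDist_comm]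
    exact hG'.ne_top
  · obtain ⟨q, hq, hpq⟩ := exists_edist_lt_of_hausdorffEDist_lt hp hG'
    have h1 := (abs_height_sub_le p q).trans_lt (edist_lt_ofReal_iff.1 hpq)
    have h2 := hG q hq
    rw [abs_lt] at h1
    linarith

end IrrationalFan

namespace CL

theorem edist_eq {X : Type*} [EMetricSpace X] (A B : CL X) :
    edist A B = hausdorffEDist (A.1 : Set X) B.1 := rfl

/-- The point of the hyperspace given by a nonempty closed set. -/
def ofIsClosed {X : Type*} [EMetricSpace X] (s : Set X) (hs : IsClosed s) (hne : s.Nonempty) :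
    CL X :=
  ⟨⟨s, hs⟩, hne⟩

/-- The closure in `Y` of a closed subset of a subspace of `Y`. -/
def closureMap {Y : Type*} [EMetricSpace Y] {P : Y → Prop} (F : CL {y // P y}) : Closeds Y :=
  Closeds.closure ((↑) '' (F.1 : Set {y // P y}))

theorem isometry_closureMap {Y : Type*} [EMetricSpace Y] {P : Y → Prop} :
    Isometry (closureMap (P := P)) := fun A B => by
  rw [Closeds.edist_eq, edist_eq]
  exact hausdorffEDist_closure.trans (hausdorffEDist_image isometry_subtype_coe)

end CL

namespace IrrationalFan

/-- The members of `CL Positive` whose heights are bounded away from zero. -/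
def boundedBelow : Set (CL Positive) := CL.closureMap ⁻¹' awayFromZero

theorem mem_boundedBelow {F : CL Positive} {ε : ℝ} (hε : 0 < ε)
    (hF : ∀ p ∈ F.1, ε ≤ p.1.height) : F ∈ boundedBelow := by
  refine ⟨(F.2.image _).closure, ε, hε, fun p hp => ?_⟩
  refine closure_minimal (t := {p : IrrationalFan | ε ≤ p.height}) ?_
    (isClosed_le continuous_const continuous_height) hp
  rintro _ ⟨q, hq, rfl⟩
  exact hF q hq

theorem awayFromZero_subset_range :
    awayFromZero ⊆ range (CL.closureMap : CL Positive → Closeds IrrationalFan) := by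
  rintro G ⟨⟨p, hp⟩, ε, hε, hG⟩
  have himage : ((↑) : Positive → IrrationalFan) '' ((↑) ⁻¹' (G : Set IrrationalFan)) = G :=
    image_preimage_eq_of_subset fun q hq => ⟨⟨q, hε.trans_le (hG q hq)⟩, rfl⟩
  refine ⟨CL.ofIsClosed (((↑) : Positive → IrrationalFan) ⁻¹' G)
    (G.isClosed.preimage continuous_subtype_val) ⟨⟨p, hε.trans_le (hG p hp)⟩, hp⟩, ?_⟩
  apply Closeds.ext
  change closure (((↑) : Positive → IrrationalFan) '' ((↑) ⁻¹' (G : Set IrrationalFan))) = G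
  rw [himage, G.isClosed.closure_eq]

theorem isCompletelyMetrizableSpace_boundedBelow :
    IsCompletelyMetrizableSpace boundedBelow := by
  have := isCompletelyMetrizableSpace_of_isOpen isOpen_awayFromZero
  have hemb := CL.isometry_closureMap (P := fun p : IrrationalFan => 0 < p.height)
    |>.isEmbedding.restrictPreimage awayFromZero
  have hsurj : Function.Surjective (awayFromZero.restrictPreimage
      (CL.closureMap : CL Positive → Closeds IrrationalFan)) := by
    rintro ⟨G, hG⟩
    obtain ⟨F, rfl⟩ := awayFromZero_subset_range hG
    exact ⟨⟨F, hG⟩, rfl⟩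
  exact IsClosedEmbedding.IsCompletelyMetrizableSpace
    ⟨hemb, hsurj.range_eq ▸ isClosed_univ⟩

theorem dense_boundedBelow : Dense boundedBelow := by
  intro F
  rw [EMetric.mem_closure_iff]
  intro r hr
  obtain ⟨δ, hδ, hδr⟩ : ∃ δ : ℝ, 0 < δ ∧ ENNReal.ofReal δ < r := by
    obtain ⟨δ, -, h0, hr⟩ := ENNReal.lt_iff_exists_real_btwn.1 hr
    exact ⟨δ, by simpa using h0, hr⟩
  set ε := min δ 1
  have hε : 0 < ε := lt_min hδ one_pos
  have hraise (p : Positive) : ∃ q : Positive, ε ≤ q.1.height ∧ dist p q ≤ ε := by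
    obtain ⟨q, hq, hqh⟩ := exists_base_eq_height_eq p.1.irrational_base
      (p.2.le.trans (le_max_left _ ε)) (max_le p.1.height_le_one (min_le_right δ 1))
    refine ⟨⟨q, hqh.symm ▸ lt_max_of_lt_left p.2⟩,
      (le_max_right _ _).trans_eq hqh.symm, ?_⟩
    rw [Subtype.dist_eq, dist_eq_of_base_eq hq.symm, hqh, abs_sub_comm, abs_of_nonneg] <;>
      cases max_cases p.1.height ε <;> linarith [p.2]
  choose raise hheight hdist using hraise
  refine ⟨CL.ofIsClosed (closure (raise '' F.1)) isClosed_closure (F.2.image _).closure,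
    mem_boundedBelow hε fun p hp => ?_, ?_⟩
  · refine closure_minimal (t := {p : Positive | ε ≤ p.1.height}) ?_
      (isClosed_le continuous_const (continuous_height.comp continuous_subtype_val)) hp
    rintro _ ⟨q, -, rfl⟩
    exact hheight q
  · refine lt_of_le_of_lt ?_ hδr
    rw [CL.edist_eq]
    refine hausdorffEDist_closure_right.trans_le ?_
    have hle (p : Positive) : edist p (raise p) ≤ ENNReal.ofReal δ := by
      rw [edist_dist]
      exact ENNReal.ofReal_le_ofReal ((hdist p).trans (min_le_left _ _))
    refine hausdorffEDist_le_of_mem_edist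
      (fun p hp => ⟨_, mem_image_of_mem _ hp, hle p⟩) ?_
    rintro _ ⟨p, hp, rfl⟩
    exact ⟨p, hp, edist_comm p (raise p) ▸ hle p⟩

/-- The distance between two reals truncated at `1`. -/
noncomputable def truncDist (x y : ℝ) : ℝ := min 1 |x - y|

theorem continuous_truncDist : Continuous fun z : ℝ × ℝ => truncDist z.1 z.2 := by
  unfold truncDist
  fun_prop

theorem truncDist_pos {q : ℚ} {y : ℝ} (hy : Irrational y) : 0 < truncDist q y :=
  lt_min one_pos (abs_pos.2 (sub_ne_zero.2 (hy.ne_rat q).symm))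

theorem abs_truncDist_sub_le (x y z : ℝ) : |truncDist x z - truncDist y z| ≤ |x - y| := by
  refine (abs_min_sub_min_le_max 1 |x - z| 1 |y - z|).trans ?_
  rw [sub_self, abs_zero, max_eq_right (abs_nonneg _)]
  refine (abs_abs_sub_abs_le _ _).trans_eq ?_
  rw [sub_sub_sub_cancel_right]

theorem exists_height_eq_truncDist (q : ℚ) {y : ℝ} (hy : Irrational y) :
    ∃ p : Positive, p.1.base = y ∧ p.1.height = truncDist q y := by
  obtain ⟨p, hp, hph⟩ := exists_base_eq_height_eq hy (truncDist_pos hy).le (min_le_left 1 |q - y|)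
  exact ⟨⟨p, hph ▸ truncDist_pos hy⟩, hp, hph⟩

/-- The graph of the truncated distance to a rational number. -/
noncomputable def graph (q : ℚ) : CL Positive :=
  CL.ofIsClosed {p | p.1.height = truncDist q p.1.base}
    (isClosed_eq (continuous_height.comp continuous_subtype_val)
      (continuous_truncDist.comp (continuous_const.prodMk
        (continuous_base.comp continuous_subtype_val))))
    (by
      obtain ⟨p, hp, hph⟩ := exists_height_eq_truncDist q irrational_sqrt_two
      exact ⟨p, hph.trans (hp ▸ rfl)⟩)

theorem mem_graph {q : ℚ} {p : Positive} :
    p ∈ (graph q).1 ↔ p.1.height = truncDist q p.1.base := Iff.rfl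

theorem edist_graph_le (q r : ℚ) : edist (graph q) (graph r) ≤ edist q r := by
  have key (q r : ℚ) (p : Positive) (hp : p ∈ (graph q).1) :
      ∃ p' ∈ (graph r).1, edist p p' ≤ edist q r := by
    obtain ⟨p', hp', hph'⟩ := exists_height_eq_truncDist r p.1.irrational_base
    refine ⟨p', mem_graph.2 (hp' ▸ hph'), ?_⟩
    rw [edist_dist, edist_dist, Subtype.dist_eq, dist_eq_of_base_eq hp'.symm, hph',
      mem_graph.1 hp, Rat.dist_eq]
    exact ENNReal.ofReal_le_ofReal (abs_truncDist_sub_le _ _ _)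
  rw [CL.edist_eq]
  exact hausdorffEDist_le_of_mem_edist (key q r) fun p hp => edist_comm r q ▸ key r q p hp

theorem abs_height_sub_truncDist_lt {F : CL Positive} {q : ℚ} {δ : ℝ} (hδ : δ ≤ 1)
    (hF : edist F (graph q) < ENNReal.ofReal δ) {p : Positive} (hp : p ∈ F.1) :
    |p.1.height - truncDist q p.1.base| < δ := by
  obtain ⟨p', hp', hlt⟩ := exists_edist_lt_of_hausdorffEDist_lt hp hF
  have hlt : dist p.1 p'.1 < δ := edist_lt_ofReal_iff.1 hlt
  have hbase := base_eq_of_dist_lt_one (hlt.trans_le hδ)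
  rwa [dist_eq_of_base_eq hbase, mem_graph.1 hp', ← hbase] at hlt

theorem dist_le_of_edist_graph_lt {q r : ℚ} {δ : ℝ} (hδ : δ < 1)
    (h : edist (graph q) (graph r) < ENNReal.ofReal δ) : dist q r ≤ δ := by
  have hirr (y : ℝ) (hy : Irrational y) : |truncDist q y - truncDist r y| ≤ δ := by
    obtain ⟨p, hp, hph⟩ := exists_height_eq_truncDist q hy
    have := abs_height_sub_truncDist_lt hδ.le h (mem_graph.2 (hp ▸ hph))
    rw [hph, hp] at this
    exact this.le
  have hcont (x : ℝ) : Continuous (truncDist x) :=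
    continuous_truncDist.comp (continuous_const.prodMk continuous_id)
  have hall : ∀ y : ℝ, |truncDist q y - truncDist r y| ≤ δ := fun y =>
    closure_minimal (t := {y | |truncDist q y - truncDist r y| ≤ δ}) hirr
      (isClosed_le ((hcont q).sub (hcont r)).abs continuous_const) (dense_irrational y)
  have hr := hall r
  simp only [truncDist, sub_self, abs_zero, min_eq_right zero_le_one, sub_zero] at hr
  rw [abs_of_nonneg (le_min zero_le_one (abs_nonneg _)), min_le_iff] at hr
  exact hr.resolve_left hδ.not_ge

theorem isUniformInducing_graph : IsUniformInducing graph := by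
  rw [EMetric.isUniformInducing_iff]
  refine ⟨(LipschitzWith.of_edist_le edist_graph_le).uniformContinuous, fun δ hδ => ?_⟩
  obtain ⟨ε, -, hε, hεδ⟩ := ENNReal.lt_iff_exists_real_btwn.1 hδ
  have hε : 0 < ε := by simpa using hε
  refine ⟨ENNReal.ofReal (min ε (1 / 2)), by simpa using hε, fun {a b} hab => ?_⟩
  have := dist_le_of_edist_graph_lt ((min_le_right ε (1 / 2)).trans_lt (by norm_num)) hab
  rw [edist_dist]
  exact (ENNReal.ofReal_le_ofReal (this.trans (min_le_left _ _))).trans_lt hεδ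

theorem height_eq_of_tendsto_graph {q : ℕ → ℚ} {F : CL Positive} {x : ℝ}
    (hF : Tendsto (fun n => graph (q n)) atTop (𝓝 F))
    (hx : Tendsto (fun n => (q n : ℝ)) atTop (𝓝 x)) {p : Positive} (hp : p ∈ F.1) :
    p.1.height = truncDist x p.1.base := by
  have h1 : Tendsto (fun n => truncDist (q n) p.1.base) atTop (𝓝 (truncDist x p.1.base)) :=
    ((continuous_truncDist.comp (continuous_id.prodMk continuous_const)).tendsto x).comp hx
  refine tendsto_nhds_unique (Metric.tendsto_atTop.2 fun ε hε => ?_) h1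
  obtain ⟨N, hN⟩ := EMetric.tendsto_atTop.1 hF (ENNReal.ofReal (min ε 1))
    (by simpa using hε)
  refine ⟨N, fun n hn => ?_⟩
  rw [dist_comm, Real.dist_eq]
  exact (abs_height_sub_truncDist_lt (min_le_right _ _) (edist_comm F _ ▸ hN n hn) hp).trans_le
    (min_le_left _ _)

theorem exists_mem_base_eq {F : CL Positive} {q : ℚ} (hF : edist (graph q) F < 1) {y : ℝ}
    (hy : Irrational y) : ∃ p ∈ F.1, p.1.base = y := by
  obtain ⟨p, hp, hph⟩ := exists_height_eq_truncDist q hy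
  obtain ⟨p', hp', hlt⟩ := exists_edist_lt_of_hausdorffEDist_lt (mem_graph.2 (hp ▸ hph)) hF
  rw [← ENNReal.ofReal_one] at hlt
  have hlt : dist p.1 p'.1 < 1 := edist_lt_ofReal_iff.1 hlt
  exact ⟨p', hp', (base_eq_of_dist_lt_one hlt).symm.trans hp⟩

theorem isClosed_range_graph : IsClosed (range graph) := by
  refine IsSeqClosed.isClosed fun u F hu hF => ?_
  choose q hq using hu
  obtain rfl : (fun n => graph (q n)) = u := funext hq
  have hcauchy : CauchySeq q :=
    isUniformInducing_graph.cauchy_map_iff.1 hF.cauchySeq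
  obtain ⟨x, hx⟩ := cauchySeq_tendsto_of_complete
    (Rat.isUniformEmbedding_coe_real.uniformContinuous.comp_cauchySeq hcauchy)
  by_cases hirr : Irrational x
  · obtain ⟨N, hN⟩ := EMetric.tendsto_atTop.1 hF 1 one_pos
    obtain ⟨p, hp, rfl⟩ := exists_mem_base_eq (hN N le_rfl) hirr
    have := height_eq_of_tendsto_graph hF hx hp
    rw [truncDist, sub_self, abs_zero, min_eq_right zero_le_one] at this
    exact absurd this p.2.ne'
  · obtain ⟨r, rfl⟩ := not_not.1 hirr
    have hr : Tendsto q atTop (𝓝 r) :=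
      Rat.isUniformEmbedding_coe_real.isEmbedding.tendsto_nhds_iff.2 hx
    exact ⟨r, tendsto_nhds_unique
      ((isUniformInducing_graph.uniformContinuous.continuous.tendsto r).comp hr) hF⟩

theorem isClosedEmbedding_graph : IsClosedEmbedding graph :=
  ⟨isUniformInducing_graph.isUniformEmbedding.isEmbedding, isClosed_range_graph⟩

end IrrationalFan

/-- There is a bounded metric space `(X, d)` with `X` completely metrizable such that the
hyperspace `CL(X)` with the Hausdorff metric `H_d` simultaneously: (i) contains a closed
subspace homeomorphic to `ℚ`, hence is not completely metrizable; and (ii) contains a dense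
completely metrizable subspace, hence is a Baire space. -/
theorem stmt13 :
    ∃ (X : Type) (_ : MetricSpace X),
      (∃ C : ℝ, ∀ x y : X, dist x y ≤ C) ∧
      IsCompletelyMetrizable X ∧
      (∃ Q : Set (CL X), IsClosed Q ∧ Nonempty (Q ≃ₜ ℚ)) ∧
      ¬ IsCompletelyMetrizable (CL X) ∧
      (∃ S : Set (CL X), Dense S ∧ IsCompletelyMetrizable ↥S) ∧
      BaireSpace (CL X) := by
  have hS := IrrationalFan.isCompletelyMetrizableSpace_boundedBelow
  refine ⟨IrrationalFan.Positive, inferInstance,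
    ⟨3, fun x y => IrrationalFan.dist_le_three x y⟩,
    isCompletelyMetrizable_iff.2 IrrationalFan.isCompletelyMetrizableSpace_positive,
    ⟨_, IrrationalFan.isClosed_range_graph,
      ⟨IrrationalFan.isClosedEmbedding_graph.isEmbedding.toHomeomorph.symm⟩⟩,
    fun h => ?_,
    ⟨_, IrrationalFan.dense_boundedBelow, isCompletelyMetrizable_iff.2 hS⟩,
    baireSpace_of_dense_baireSpace IrrationalFan.dense_boundedBelow⟩
  have := isCompletelyMetrizable_iff.1 h
  exact Rat.not_isCompletelyMetrizableSpace
    IrrationalFan.isClosedEmbedding_graph.IsCompletelyMetrizableSpace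
end
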